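/- Let a, b, c, d be four pairwise distinct elements with ι = {a, b, c, d}, and suppose the maxsets of the family (K i) are exactly the four sets {a,b}, {b,c}, {c,d}, {d,a}. Then there is no priority ordering P such that the maxsets minimal with respect to P are exactly {a,b} and {c,d}. -/

import Mathlib

/-- The models of a set `M` of formula indices: the interpretations satisfying
`K i` for every `i ∈ M`. -/
def KMod {V ι : Type*} (K : ι → Set (V → Bool)) (M : Set ι) : Set (V → Bool) :=
  {I | ∀ i ∈ M, I ∈ K i}

/-- A set of formula indices is consistent if it has a model. -/
def ConsistentSet {V ι : Type*} (K : ι → Set (V → Bool)) (M : Set ι) : Prop :=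
  (KMod K M).Nonempty

/-- A maxset: a maximally consistent subset of the family. -/
def Maxset {V ι : Type*} (K : ι → Set (V → Bool)) (M : Set ι) : Prop :=
  ConsistentSet K M ∧ ∀ j ∉ M, ¬ ConsistentSet K (M ∪ {j})

/-- A priority ordering: every formula is in some class `≥ 1`, and the first
class is nonempty. -/
def PriorityOrdering {ι : Type*} (P : ι → ℕ) : Prop :=
  (∀ i, 1 ≤ P i) ∧ (∃ i, P i = 1)

/-- The comparison of sets of formulae induced by a priority ordering `P`. -/
def PLt {ι : Type*} (P : ι → ℕ) (M N : Set ι) : Prop :=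
  ∃ n, 1 ≤ n ∧ (∀ m, 1 ≤ m → m < n → {i ∈ M | P i = m} = {i ∈ N | P i = m}) ∧
    {i ∈ N | P i = n} ⊂ {i ∈ M | P i = n}

/-- A maxset is minimal w.r.t. `P` when no consistent set is below it. -/
def MinimalMaxset {V ι : Type*} (K : ι → Set (V → Bool)) (P : ι → ℕ)
    (M : Set ι) : Prop :=
  Maxset K M ∧ ¬ ∃ N : Set ι, ConsistentSet K N ∧ PLt P N M

/-- The result of merging the family `K` under the priority ordering `P`:
the union of the models of the minimal maxsets. -/
def MergeResult {V ι : Type*} (K : ι → Set (V → Bool)) (P : ι → ℕ) :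
    Set (V → Bool) :=
  ⋃ M ∈ {M : Set ι | MinimalMaxset K P M}, KMod K M

theorem ConsistentSet.mono {V ι : Type*} {K : ι → Set (V → Bool)} {M N : Set ι}
    (hMN : M ⊆ N) (hN : ConsistentSet K N) : ConsistentSet K M :=
  hN.imp fun _ hI i hi => hI i (hMN hi)

/-- Every consistent subset of a finite family extends to a maxset. -/
theorem ConsistentSet.exists_maxset_superset {V ι : Type*} [Finite ι]
    {K : ι → Set (V → Bool)} {N : Set ι} (hN : ConsistentSet K N) :
    ∃ M, N ⊆ M ∧ Maxset K M := by
  obtain ⟨M, hNM, hM⟩ := (Set.toFinite {M : Set ι | ConsistentSet K M}).exists_le_maximal hN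
  exact ⟨M, hNM, hM.prop, fun j hj hc =>
    hj (hM.le_of_ge hc Set.subset_union_left (Or.inr rfl))⟩

/-- Replacing an element of a pair by one of a strictly smaller class yields a lower pair. -/
theorem PLt.pair_of_lt {ι : Type*} {P : ι → ℕ} {x y z : ι} (hx : 1 ≤ P x) (hxy : x ≠ y)
    (hxz : P x < P z) : PLt P {x, y} {y, z} := by
  refine ⟨P x, hx, fun m _ hm => ?_, Set.ssubset_iff_exists.2 ⟨?_, x, ?_, ?_⟩⟩
  · ext i
    simp only [Set.mem_ofPred_eq, Set.mem_insert_iff, Set.mem_singleton_iff]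
    grind
  · rintro i ⟨rfl | rfl, hi⟩
    · exact ⟨Or.inr rfl, hi⟩
    · exact absurd hi hxz.ne'
  · exact ⟨Or.inl rfl, rfl⟩
  · rintro ⟨h | h, -⟩
    · exact hxy h
    · exact hxz.ne (congrArg P h)

/-- If every element outside `M` shares its class with an element of `M` with which it is
jointly inconsistent, no consistent set is below `M`. -/
theorem ConsistentSet.not_pLt {V ι : Type*} {K : ι → Set (V → Bool)} {P : ι → ℕ}
    {M N : Set ι} (hN : ConsistentSet K N)
    (h : ∀ x ∉ M, ∃ y ∈ M, P y = P x ∧ ¬ ConsistentSet K {x, y}) : ¬ PLt P N M := by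
  rintro ⟨n, -, -, hss⟩
  obtain ⟨hsub, x, ⟨hxN, hx⟩, hxM⟩ := Set.ssubset_iff_exists.1 hss
  obtain ⟨y, hyM, hyx, hincons⟩ := h x fun hx' => hxM ⟨hx', hx⟩
  exact hincons (hN.mono (Set.pair_subset hxN (hsub ⟨hyM, hyx.trans hx⟩).1))

theorem stmt_12 {V ι : Type*} [Fintype V] [Fintype ι] [Nonempty ι]
    (K : ι → Set (V → Bool)) (hK : ∀ i, (K i).Nonempty)
    (a b c d : ι)
    (hab : a ≠ b) (hac : a ≠ c) (had : a ≠ d)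
    (hbc : b ≠ c) (hbd : b ≠ d) (hcd : c ≠ d)
    (huniv : ∀ i : ι, i = a ∨ i = b ∨ i = c ∨ i = d)
    (hmax : {M : Set ι | Maxset K M} =
      {({a, b} : Set ι), {b, c}, {c, d}, {d, a}}) :
    ¬ ∃ P : ι → ℕ, PriorityOrdering P ∧
      {M : Set ι | MinimalMaxset K P M} = {({a, b} : Set ι), {c, d}} := by
  rintro ⟨P, ⟨hP, -⟩, hmin⟩
  have hmem (M : Set ι) : Maxset K M ↔ M = {a, b} ∨ M = {b, c} ∨ M = {c, d} ∨ M = {d, a} :=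
    Set.ext_iff.1 hmax M
  have hmin_mem (M : Set ι) : MinimalMaxset K P M ↔ M = {a, b} ∨ M = {c, d} :=
    Set.ext_iff.1 hmin M
  have hbc_max : Maxset K {b, c} := (hmem _).2 (by simp)
  have hda_max : Maxset K {d, a} := (hmem _).2 (by simp)
  have hab_min := ((hmin_mem {a, b}).2 (Or.inl rfl)).2
  have hcd_min := ((hmin_mem {c, d}).2 (Or.inr rfl)).2
  have hac_eq : P a = P c := by
    refine le_antisymm (not_lt.1 fun h => hab_min ⟨_, hbc_max.1, ?_⟩)
      (not_lt.1 fun h => hcd_min ⟨_, hda_max.1, ?_⟩)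
    · simpa only [Set.pair_comm] using PLt.pair_of_lt (hP c) hbc.symm h
    · simpa only [Set.pair_comm] using PLt.pair_of_lt (hP a) had h
  have hbd_eq : P b = P d := by
    refine le_antisymm (not_lt.1 fun h => hab_min ⟨_, hda_max.1, ?_⟩)
      (not_lt.1 fun h => hcd_min ⟨_, hbc_max.1, ?_⟩)
    · exact PLt.pair_of_lt (hP d) had.symm h
    · exact PLt.pair_of_lt (hP b) hbc h
  have hac_incons : ¬ ConsistentSet K {a, c} := by
    intro h
    obtain ⟨M, hsub, hM⟩ := h.exists_maxset_superset
    have ha : a ∈ M := hsub (by simp)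
    have hc : c ∈ M := hsub (by simp)
    rcases (hmem M).1 hM with rfl | rfl | rfl | rfl <;> simp_all [eq_comm]
  have hbd_incons : ¬ ConsistentSet K {d, b} := by
    intro h
    obtain ⟨M, hsub, hM⟩ := h.exists_maxset_superset
    have hd : d ∈ M := hsub (by simp)
    have hb : b ∈ M := hsub (by simp)
    rcases (hmem M).1 hM with rfl | rfl | rfl | rfl <;> simp_all [eq_comm]
  have hbc_min : MinimalMaxset K P {b, c} := by
    refine ⟨hbc_max, fun ⟨N, hN, hlt⟩ => hN.not_pLt (fun x hx => ?_) hlt⟩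
    rcases huniv x with rfl | rfl | rfl | rfl
    · exact ⟨c, by simp, hac_eq.symm, hac_incons⟩
    · simp at hx
    · simp at hx
    · exact ⟨b, by simp, hbd_eq, hbd_incons⟩
  rcases (hmin_mem _).1 hbc_min with h | h
  · have : c ∈ ({a, b} : Set ι) := h ▸ (by simp)
    rcases this with h | h
    · exact hac h.symm
    · exact hbc h.symm
  · have : b ∈ ({c, d} : Set ι) := h ▸ (by simp)
    rcases this with h | h
    · exact hbc h
    · exact hbd h
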